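/- There is a universal constant C ≥ 3 such that every linear hypergraph H with no rank-1 edges, maximum rank P and maximum degree Δ satisfying P ≥ C and Δ ≥ C(P − 1) has q_list(H) ≤ Δ(P − 1). -/

import Mathlib

open Finset

variable {V : Type*} [DecidableEq V]

/-- A proper list edge coloring of the hypergraph with edge set `E` from the lists `L`:
each edge gets a color from its list, and two distinct edges get the same color
only if they are disjoint. -/
def IsProperListColoring (E : Finset (Finset V)) (L : Finset V → Finset ℕ)
    (γ : Finset V → ℕ) : Prop :=
  (∀ e ∈ E, γ e ∈ L e) ∧ ∀ e ∈ E, ∀ f ∈ E, e ≠ f → γ e = γ f → Disjoint e f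

/-- `E` is `k`-list-edge-colorable: for every assignment of lists of size `k`
there is a proper list edge coloring. -/
def ListColorable (E : Finset (Finset V)) (k : ℕ) : Prop :=
  ∀ L : Finset V → Finset ℕ, (∀ e ∈ E, (L e).card = k) →
    ∃ γ : Finset V → ℕ, IsProperListColoring E L γ

/-- The list edge chromatic number `q_list`: the least `k` such that `E` is
`k`-list-edge-colorable. -/
noncomputable def qList (E : Finset (Finset V)) : ℕ :=
  sInf {k | ListColorable E k}

/-- The degree of a vertex: the number of edges containing it. -/
def deg (E : Finset (Finset V)) (x : V) : ℕ := (E.filter fun e => x ∈ e).card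

/-- The clique rank of an edge: `R(e) = ∑_{x ∈ e} (d(x) - 1)`. -/
def cliqueRank (E : Finset (Finset V)) (e : Finset V) : ℕ :=
  ∑ x ∈ e, (deg E x - 1)

/-- The clique degree of a vertex: `D(x) = ∑_{e ∋ x} (r(e) - 1)`. -/
def cliqueDeg (E : Finset (Finset V)) (x : V) : ℕ :=
  ∑ e ∈ E.filter (fun e => x ∈ e), (e.card - 1)

/-- A hypergraph is linear if any two distinct edges meet in at most one vertex. -/
def Linear (E : Finset (Finset V)) : Prop :=
  ∀ e ∈ E, ∀ f ∈ E, e ≠ f → (e ∩ f).card ≤ 1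

/-- The number of triangles with side `e`: unordered pairs `{f, g}` of edges
distinct from `e` such that `e, f, g` pairwise intersect. -/
def numTriangles (E : Finset (Finset V)) (e : Finset V) : ℕ :=
  (((E.erase e).powersetCard 2).filter fun p =>
    (∀ f ∈ p, (e ∩ f).Nonempty) ∧ ∀ f ∈ p, ∀ g ∈ p, f ≠ g → (f ∩ g).Nonempty).card

section CodegreeColoring

variable {α : Type*}

/-- The colors in the list of `v` that `γ` uses on no neighbor of `v` in `S`. -/
def available (G : SimpleGraph α) [DecidableRel G.Adj] (L : α → Finset ℕ) (S : Finset α)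
    (v : α) (γ : α → ℕ) : Finset ℕ :=
  (L v).filter fun c => ∀ u ∈ S, G.Adj v u → γ u ≠ c

/-- The proper colorings of `G[S]` from the lists `L`, extended by `0` outside `S`. -/
def listColorings [DecidableEq α] [Fintype α] (G : SimpleGraph α) [DecidableRel G.Adj] (L : α → Finset ℕ)
    (S : Finset α) : Finset (α → ℕ) :=
  (Fintype.piFinset fun u => if u ∈ S then L u else {0}).filter fun γ =>
    ∀ u ∈ S, ∀ w ∈ S, G.Adj u w → γ u ≠ γ w

/-- The expected number of neighbors of `v` in `S` that receive the color `c`, if each of them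
chooses uniformly among the colors not used on its neighbors in `S` outside the neighborhood
of `v`. -/
def colorWeight (G : SimpleGraph α) [DecidableRel G.Adj] (L : α → Finset ℕ) (S : Finset α)
    (v : α) (γ : α → ℕ) (c : ℕ) : ℚ :=
  ∑ f ∈ S.filter (G.Adj v), if c ∈ available G L (S.filter fun u => ¬ G.Adj v u) f γ then
    ((available G L (S.filter fun u => ¬ G.Adj v u) f γ).card : ℚ)⁻¹ else 0

/-- The colorings of `G[S]` in which `c` has weight at most `8` and appears on exactly `j`
neighbors of `v`, each with at least `2 * t` colors not used outside the neighborhood of `v`. -/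
def niceColorings [DecidableEq α] [Fintype α] (G : SimpleGraph α) [DecidableRel G.Adj] (L : α → Finset ℕ)
    (S : Finset α) (v : α) (t : ℕ) (c j : ℕ) : Finset (α → ℕ) :=
  (listColorings G L S).filter fun γ => colorWeight G L S v γ c ≤ 8 ∧
    ((S.filter (G.Adj v)).filter fun f => γ f = c).card = j ∧
    ∀ f ∈ S.filter (G.Adj v), γ f = c →
      2 * t ≤ (available G L (S.filter fun u => ¬ G.Adj v u) f γ).card

variable {G : SimpleGraph α} [DecidableRel G.Adj] {L : α → Finset ℕ} {S : Finset α}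

lemma mem_available {v : α} {γ : α → ℕ} {c : ℕ} :
    c ∈ available G L S v γ ↔ c ∈ L v ∧ ∀ u ∈ S, G.Adj v u → γ u ≠ c := by
  simp [available]

lemma available_congr {v : α} {γ γ' : α → ℕ} (h : ∀ u ∈ S, G.Adj v u → γ u = γ' u) :
    available G L S v γ = available G L S v γ' := by
  ext c
  simp only [mem_available]
  refine and_congr_right fun _ => forall₂_congr fun u hu => ?_
  exact forall_congr' fun hvu => by rw [h u hu hvu]

lemma available_mono {S' : Finset α} (h : S' ⊆ S) (v : α) (γ : α → ℕ) :
    available G L S v γ ⊆ available G L S' v γ := by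
  intro c
  simp only [mem_available]
  exact fun hc => ⟨hc.1, fun u hu => hc.2 u (h hu)⟩

lemma colorWeight_congr {v : α} {γ γ' : α → ℕ} (h : ∀ u, ¬ G.Adj v u → γ u = γ' u) (c : ℕ) :
    colorWeight G L S v γ c = colorWeight G L S v γ' c := by
  unfold colorWeight
  refine Finset.sum_congr rfl fun f _ => ?_
  rw [available_congr (γ := γ) (γ' := γ')]
  exact fun u hu _ => h u (Finset.mem_filter.1 hu).2

/-- Neighbors of `v` gain few available colors when their common neighbors with `v` are
ignored. -/
lemma card_available_outer_le {t : ℕ} {v f : α} (γ : α → ℕ)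
    (hcodeg : (S.filter fun u => G.Adj v u ∧ G.Adj f u).card ≤ t) :
    (available G L (S.filter fun u => ¬ G.Adj v u) f γ).card ≤
      (available G L S f γ).card + t := by
  have hsub : available G L (S.filter fun u => ¬ G.Adj v u) f γ ⊆
      available G L S f γ ∪ (S.filter fun u => G.Adj v u ∧ G.Adj f u).image γ := by
    intro c hc
    simp only [mem_available, Finset.mem_union, Finset.mem_image, Finset.mem_filter] at hc ⊢
    by_contra! hcon
    obtain ⟨u, hu, hfu, huc⟩ := hcon.1 hc.1
    by_cases hvu : G.Adj v u
    · exact hcon.2 u ⟨hu, hvu, hfu⟩ huc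
    · exact hc.2 u ⟨hu, hvu⟩ hfu huc
  calc _ ≤ _ := Finset.card_le_card hsub
    _ ≤ _ := Finset.card_union_le _ _
    _ ≤ _ := by gcongr; exact Finset.card_image_le.trans hcodeg

lemma sum_colorWeight_le (v : α) (γ : α → ℕ) (T : Finset ℕ) :
    ∑ c ∈ T, colorWeight G L S v γ c ≤ (S.filter (G.Adj v)).card := by
  unfold colorWeight
  rw [Finset.sum_comm, ← nsmul_one (S.filter (G.Adj v)).card, ← Finset.sum_const]
  refine Finset.sum_le_sum fun f _ => ?_
  rw [← Finset.sum_filter, Finset.sum_const, nsmul_eq_mul]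
  set A := available G L (S.filter fun u => ¬ G.Adj v u) f γ
  have hle : (T.filter (· ∈ A)).card ≤ A.card :=
    Finset.card_le_card fun c hc => (Finset.mem_filter.1 hc).2
  calc ((T.filter (· ∈ A)).card : ℚ) * (A.card : ℚ)⁻¹ ≤ A.card * (A.card : ℚ)⁻¹ := by gcongr
    _ ≤ 1 := mul_inv_le_one

lemma colorWeight_nonneg (v : α) (γ : α → ℕ) (c : ℕ) : 0 ≤ colorWeight G L S v γ c :=
  Finset.sum_nonneg fun _ _ => by split_ifs <;> positivity

/-- Markov's inequality for the counting measure on a finset. -/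
lemma eight_mul_card_le_sum {ι : Type*} {T T' : Finset ι} {w : ι → ℚ} (hsub : T' ⊆ T)
    (hw : ∀ i ∈ T, 0 ≤ w i) (hT' : ∀ i ∈ T', 8 ≤ w i) :
    8 * (T'.card : ℚ) ≤ ∑ i ∈ T, w i := by
  calc 8 * (T'.card : ℚ) = ∑ i ∈ T', 8 := by simp [mul_comm]
    _ ≤ ∑ i ∈ T', w i := Finset.sum_le_sum hT'
    _ ≤ _ := Finset.sum_le_sum_of_subset_of_nonneg hsub fun i hi _ => hw i hi

variable [DecidableEq α]

lemma available_insert_self (u : α) (γ : α → ℕ) :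
    available G L (insert u S) u γ = available G L S u γ := by
  ext c
  simp [mem_available]

variable [Fintype α]

lemma mem_listColorings {γ : α → ℕ} :
    γ ∈ listColorings G L S ↔ (∀ u ∈ S, γ u ∈ L u) ∧ (∀ u ∉ S, γ u = 0) ∧
      ∀ u ∈ S, ∀ w ∈ S, G.Adj u w → γ u ≠ γ w := by
  simp only [listColorings, Finset.mem_filter, Fintype.mem_piFinset]
  rw [← and_assoc]
  refine and_congr_left fun _ => ⟨fun h => ⟨fun u hu => ?_, fun u hu => ?_⟩, fun h u => ?_⟩
  · simpa [hu] using h u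
  · simpa [hu] using h u
  · by_cases hu : u ∈ S
    · simpa [hu] using h.1 u hu
    · simpa [hu] using h.2 u hu

lemma mem_available_of_mem_listColorings {γ : α → ℕ} (hγ : γ ∈ listColorings G L S) {f : α}
    (hf : f ∈ S) : γ f ∈ available G L S f γ := by
  rw [mem_listColorings] at hγ
  exact mem_available.2 ⟨hγ.1 f hf, fun u hu hfu => (hγ.2.2 f hf u hu hfu).symm⟩

/-- Recoloring one vertex with an available color. -/
lemma update_mem_listColorings {γ : α → ℕ} (hγ : γ ∈ listColorings G L S) {f : α}
    (hf : f ∈ S) {c : ℕ} (hc : c ∈ available G L S f γ) :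
    Function.update γ f c ∈ listColorings G L S := by
  rw [mem_listColorings] at hγ ⊢
  rw [mem_available] at hc
  obtain ⟨h1, h2, h3⟩ := hγ
  refine ⟨fun u hu => ?_, fun u hu => ?_, fun u hu w hw huw => ?_⟩
  · by_cases huf : u = f
    · subst huf; simpa using hc.1
    · simpa [huf] using h1 u hu
  · have huf : u ≠ f := fun h => hu (h ▸ hf)
    simpa [huf] using h2 u hu
  · by_cases huf : u = f
    · subst huf
      simpa [huw.ne'] using (hc.2 w hw huw).symm
    · by_cases hwf : w = f
      · subst hwf
        simpa [huf] using hc.2 u hu huw.symm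
      · simpa [huf, hwf] using h3 u hu w hw huw

lemma update_zero_mem_listColorings {u : α} (hu : u ∉ S) {γ : α → ℕ}
    (hγ : γ ∈ listColorings G L (insert u S)) :
    Function.update γ u 0 ∈ listColorings G L S := by
  rw [mem_listColorings] at hγ ⊢
  obtain ⟨h1, h2, h3⟩ := hγ
  have hne : ∀ x ∈ S, x ≠ u := fun x hx h => hu (h ▸ hx)
  refine ⟨fun x hx => ?_, fun x hx => ?_, fun x hx y hy hxy => ?_⟩
  · simpa [hne x hx] using h1 x (by simp [hx])
  · by_cases hxu : x = u
    · simp [hxu]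
    · simpa [hxu] using h2 x (by simp [hx, hxu])
  · simpa [hne x hx, hne y hy] using h3 x (by simp [hx]) y (by simp [hy]) hxy

lemma filter_update_zero_eq_image {u : α} (hu : u ∉ S) {γ : α → ℕ}
    (hγ : γ ∈ listColorings G L S) :
    ((listColorings G L (insert u S)).filter fun γ' => Function.update γ' u 0 = γ) =
      (available G L S u γ).image (Function.update γ u) := by
  have hne : ∀ x ∈ S, x ≠ u := fun x hx h => hu (h ▸ hx)
  ext γ'
  simp only [Finset.mem_filter, Finset.mem_image]
  constructor
  · rintro ⟨hγ', rfl⟩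
    refine ⟨γ' u, ?_, by simp⟩
    rw [mem_listColorings] at hγ'
    refine mem_available.2 ⟨hγ'.1 u (by simp), fun x hx hux => ?_⟩
    simpa [hne x hx] using (hγ'.2.2 u (by simp) x (by simp [hx]) hux).symm
  · rintro ⟨c, hc, rfl⟩
    rw [mem_available] at hc
    rw [mem_listColorings] at hγ ⊢
    obtain ⟨h1, h2, h3⟩ := hγ
    refine ⟨⟨fun x hx => ?_, fun x hx => ?_, fun x hx y hy hxy => ?_⟩, ?_⟩
    · by_cases hxu : x = u
      · subst hxu; simpa using hc.1
      · simpa [hxu] using h1 x (by simpa [hxu] using hx)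
    · have hx' : x ≠ u ∧ x ∉ S := by simpa using hx
      simpa [hx'.1] using h2 x hx'.2
    · by_cases hxu : x = u
      · subst hxu
        have hyx := hxy.ne'
        simpa [hyx] using (hc.2 y (by simpa [hyx] using hy) hxy).symm
      · by_cases hyu : y = u
        · subst hyu
          simpa [hxu] using hc.2 x (by simpa [hxu] using hx) hxy.symm
        · simpa [hxu, hyu] using
            h3 x (by simpa [hxu] using hx) y (by simpa [hyu] using hy) hxy
    · rw [Function.update_idem, ← h2 u hu, Function.update_eq_self]

lemma card_filter_update_zero {u : α} (hu : u ∉ S) {γ : α → ℕ}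
    (hγ : γ ∈ listColorings G L S) :
    ((listColorings G L (insert u S)).filter fun γ' => Function.update γ' u 0 = γ).card =
      (available G L S u γ).card := by
  rw [filter_update_zero_eq_image hu hγ,
    Finset.card_image_of_injective _ (Function.update_injective γ u)]

lemma card_listColorings_insert {u : α} (hu : u ∉ S) :
    (listColorings G L (insert u S)).card =
      ∑ γ ∈ listColorings G L S, (available G L S u γ).card := by
  rw [Finset.card_eq_sum_card_fiberwise
    (f := fun γ => Function.update γ u 0) (t := listColorings G L S)
    fun γ hγ => update_zero_mem_listColorings hu hγ]
  exact Finset.sum_congr rfl fun γ hγ => card_filter_update_zero hu hγ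

/-- Few colorings leave fewer than `s` available colors at a given vertex. -/
lemma card_filter_card_available_lt_le {u : α} (hu : u ∉ S) (s : ℕ) :
    ((listColorings G L (insert u S)).filter fun γ =>
      (available G L (insert u S) u γ).card < s).card ≤ s * (listColorings G L S).card := by
  refine Finset.card_le_mul_card_image_of_maps_to
    (f := fun γ => Function.update γ u 0)
    (fun γ hγ => update_zero_mem_listColorings hu (Finset.mem_filter.1 hγ).1) s
    fun γ hγ => ?_
  by_cases hs : (available G L S u γ).card < s
  · refine le_trans ?_ hs.le
    rw [← card_filter_update_zero hu hγ]
    exact Finset.card_le_card (Finset.filter_subset_filter _ (Finset.filter_subset _ _))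
  · convert Nat.zero_le s
    rw [Finset.card_eq_zero, Finset.filter_eq_empty_iff]
    rintro γ' hγ' rfl
    apply hs
    rw [Finset.mem_filter, available_insert_self] at hγ'
    rw [available_congr (γ' := γ')]
    · exact hγ'.2
    · exact fun x _ hux => by simp [hux.ne']

lemma update_mem_niceColorings {v f : α} {t c c' j : ℕ} {γ : α → ℕ}
    (hγ : γ ∈ niceColorings G L S v t c (j + 1)) (hf : f ∈ S.filter (G.Adj v)) (hfc : γ f = c)
    (hc' : c' ∈ (available G L S f γ).erase c) :
    Function.update γ f c' ∈ niceColorings G L S v t c j := by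
  obtain ⟨hfS, hvf⟩ := Finset.mem_filter.1 hf
  obtain ⟨hne, hav⟩ := Finset.mem_erase.1 hc'
  obtain ⟨hcol, hw, hcard, hgood⟩ := Finset.mem_filter.1 hγ
  have hagree : ∀ u, ¬ G.Adj v u → Function.update γ f c' u = γ u := by
    intro u hu
    have : u ≠ f := fun h => hu (h ▸ hvf)
    simp [this]
  refine Finset.mem_filter.2 ⟨update_mem_listColorings hcol hfS hav, ?_, ?_, ?_⟩
  · rwa [colorWeight_congr hagree]
  · have : ((S.filter (G.Adj v)).filter fun x => Function.update γ f c' x = c) =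
        ((S.filter (G.Adj v)).filter fun x => γ x = c).erase f := by
      ext x
      by_cases hx : x = f
      · subst hx; simp [hne]
      · simp [hx]
    rw [this, Finset.card_erase_of_mem (Finset.mem_filter.2 ⟨hf, hfc⟩), hcard]
    rfl
  · intro g hg hgc
    have hgf : g ≠ f := by
      rintro rfl
      exact hne (by simpa using hgc)
    rw [available_congr (γ' := γ) fun u hu _ => hagree u (Finset.mem_filter.1 hu).2]
    exact hgood g hg (by simpa [hgf] using hgc)

/-- Switching: recoloring one vertex compares the numbers of colorings in which `c` appears
`j + 1` and `j` times around `v`. -/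
lemma card_niceColorings_succ_le {v : α} {t : ℕ} (ht : 2 ≤ t)
    (hcodeg : ∀ f ∈ S.filter (G.Adj v), (S.filter fun u => G.Adj v u ∧ G.Adj f u).card ≤ t)
    (c j : ℕ) :
    (niceColorings G L S v t c (j + 1)).card ≤ 32 * (niceColorings G L S v t c j).card := by
  set N := S.filter (G.Adj v) with hN
  set A : α → (α → ℕ) → Finset ℕ :=
    fun f γ => available G L (S.filter fun u => ¬ G.Adj v u) f γ with hA
  set X := niceColorings G L S v t c with hX
  have hA_update : ∀ f ∈ N, ∀ (γ : α → ℕ) (a : ℕ) (g : α),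
      A g (Function.update γ f a) = A g γ := by
    intro f hf γ a g
    refine available_congr fun u hu _ => ?_
    have : u ≠ f := fun h => (Finset.mem_filter.1 hu).2 (h ▸ (Finset.mem_filter.1 hf).2)
    simp [this]
  have hlocal : ∀ f ∈ N, ((X (j + 1)).filter fun γ => γ f = c).card ≤
      ∑ γ ∈ X j, if c ∈ A f γ then 4 * ((A f γ).card : ℚ)⁻¹ else 0 := by
    intro f hf
    have hfS := (Finset.mem_filter.1 hf).1
    set Y := (X (j + 1)).filter fun γ => γ f = c with hY
    set Z := Y.sigma fun γ => (available G L S f γ).erase c with hZ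
    have hone : ∀ γ ∈ Y, (1 : ℚ) ≤
        ∑ _c' ∈ (available G L S f γ).erase c, 4 * ((A f γ).card : ℚ)⁻¹ := by
      intro γ hγ
      obtain ⟨hγX, hfc⟩ := Finset.mem_filter.1 hγ
      obtain ⟨hcol, -, -, hgood⟩ := Finset.mem_filter.1 hγX
      have h1 : 2 * t ≤ (A f γ).card := hgood f hf hfc
      have h2 : (A f γ).card ≤ (available G L S f γ).card + t :=
        card_available_outer_le γ (hcodeg f hf)
      have h3 : ((available G L S f γ).erase c).card + 1 = (available G L S f γ).card :=
        Finset.card_erase_add_one (hfc ▸ mem_available_of_mem_listColorings hcol hfS)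
      have h4 : (A f γ).card ≤ 4 * ((available G L S f γ).erase c).card := by omega
      have hpos : (0 : ℚ) < (A f γ).card := by
        exact_mod_cast (by omega : 0 < (A f γ).card)
      have h5 : ((A f γ).card : ℚ) ≤ 4 * ((available G L S f γ).erase c).card := by
        exact_mod_cast h4
      rw [Finset.sum_const, nsmul_eq_mul, ← mul_assoc, ← div_eq_mul_inv, le_div_iff₀ hpos]
      linarith
    have hinj : Set.InjOn (fun p : (_ : α → ℕ) × ℕ => Function.update p.1 f p.2) Z := by
      rintro ⟨γ, a⟩ hp ⟨γ', a'⟩ hp' heq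
      simp only [hZ, hY, Finset.mem_coe, Finset.mem_sigma, Finset.mem_filter] at hp hp' heq
      have ha : a = a' := by simpa using congrFun heq f
      have hγ : γ = γ' := by
        ext x
        by_cases hx : x = f
        · rw [hx, hp.1.2, hp'.1.2]
        · simpa [hx] using congrFun heq x
      rw [ha, hγ]
    calc (Y.card : ℚ) = ∑ γ ∈ Y, 1 := by simp
      _ ≤ ∑ γ ∈ Y, ∑ _c' ∈ (available G L S f γ).erase c, 4 * ((A f γ).card : ℚ)⁻¹ :=
          Finset.sum_le_sum hone
      _ = ∑ p ∈ Z, 4 * ((A f p.1).card : ℚ)⁻¹ := by rw [hZ, Finset.sum_sigma]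
      _ = ∑ p ∈ Z, if c ∈ A f (Function.update p.1 f p.2) then
            4 * ((A f (Function.update p.1 f p.2)).card : ℚ)⁻¹ else 0 := by
          refine Finset.sum_congr rfl fun p hp => ?_
          obtain ⟨hpX, hfc⟩ := Finset.mem_filter.1 (Finset.mem_sigma.1 hp).1
          rw [hA_update f hf, if_pos]
          exact available_mono (Finset.filter_subset _ _) _ _
            (hfc ▸ mem_available_of_mem_listColorings (Finset.mem_filter.1 hpX).1 hfS)
      _ = ∑ γ ∈ Z.image fun p => Function.update p.1 f p.2,
            if c ∈ A f γ then 4 * ((A f γ).card : ℚ)⁻¹ else 0 :=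
          (Finset.sum_image (f := fun γ => if c ∈ A f γ then 4 * ((A f γ).card : ℚ)⁻¹ else 0)
            hinj).symm
      _ ≤ _ := by
          refine Finset.sum_le_sum_of_subset_of_nonneg ?_
            fun γ _ _ => by split_ifs <;> positivity
          intro γ' hγ'
          obtain ⟨p, hp, rfl⟩ := Finset.mem_image.1 hγ'
          obtain ⟨hp1, hp2⟩ := Finset.mem_sigma.1 hp
          obtain ⟨hpX, hfc⟩ := Finset.mem_filter.1 hp1
          exact update_mem_niceColorings hpX hf hfc hp2
  have hcount : ((X (j + 1)).card : ℚ) ≤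
      ∑ f ∈ N, (((X (j + 1)).filter fun γ => γ f = c).card : ℚ) := by
    have : (X (j + 1)).card ≤ ∑ f ∈ N, ((X (j + 1)).filter fun γ => γ f = c).card := by
      refine le_trans ?_ (Finset.sum_card_bipartiteAbove_eq_sum_card_bipartiteBelow
        (s := X (j + 1)) (t := N) fun (γ : α → ℕ) f => γ f = c).le
      rw [Finset.card_eq_sum_ones]
      refine Finset.sum_le_sum fun γ hγ => ?_
      have h : (N.filter fun f => γ f = c).card = j + 1 := (Finset.mem_filter.1 hγ).2.2.1
      rw [Finset.bipartiteAbove, h]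
      omega
    exact_mod_cast this
  have hfinal : ((X (j + 1)).card : ℚ) ≤ 32 * (X j).card :=
    calc ((X (j + 1)).card : ℚ)
        ≤ ∑ f ∈ N, ∑ γ ∈ X j, (if c ∈ A f γ then 4 * ((A f γ).card : ℚ)⁻¹ else 0) :=
          hcount.trans (Finset.sum_le_sum hlocal)
      _ = ∑ γ ∈ X j, 4 * colorWeight G L S v γ c := by
          rw [Finset.sum_comm]
          refine Finset.sum_congr rfl fun γ _ => ?_
          rw [colorWeight, Finset.mul_sum]
          exact Finset.sum_congr rfl fun f _ => by rw [mul_ite, mul_zero]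
      _ ≤ ∑ γ ∈ X j, 32 := by
          refine Finset.sum_le_sum fun γ hγ => ?_
          have : colorWeight G L S v γ c ≤ 8 := (Finset.mem_filter.1 hγ).2.1
          linarith
      _ = 32 * (X j).card := by rw [Finset.sum_const, nsmul_eq_mul, mul_comm]
  exact_mod_cast hfinal

lemma card_niceColorings_le {v : α} {t : ℕ} (ht : 2 ≤ t)
    (hcodeg : ∀ f ∈ S.filter (G.Adj v), (S.filter fun u => G.Adj v u ∧ G.Adj f u).card ≤ t)
    (c j : ℕ) :
    (niceColorings G L S v t c j).card ≤ 32 ^ j * (niceColorings G L S v t c 0).card := by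
  induction j with
  | zero => simp
  | succ j ih =>
    calc _ ≤ _ := card_niceColorings_succ_le ht hcodeg c j
      _ ≤ 32 * (32 ^ j * (niceColorings G L S v t c 0).card) := by gcongr
      _ = _ := by ring

/-- In every coloring, most colors in the list of `v` are nice, up to those used on neighbors
of `v` with few available colors. -/
lemma card_list_le_nice_add_bad {v : α} {t k : ℕ} (hk : (L v).card = k)
    (hdeg : (S.filter (G.Adj v)).card ≤ 2 * k) {γ : α → ℕ} (hγ : γ ∈ listColorings G L S) :
    k ≤ 2 * (((L v).filter fun c => ∃ j ∈ Finset.range 9,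
        γ ∈ niceColorings G L S v t c j).card +
      ((S.filter (G.Adj v)).filter fun f => (available G L S f γ).card < 2 * t).card) := by
  set N := S.filter (G.Adj v) with hN
  set mult : ℕ → ℕ := fun c => (N.filter fun f => γ f = c).card with hmult
  set heavy := (L v).filter fun c => 8 < colorWeight G L S v γ c with hheavy
  set frequent := (L v).filter fun c => 8 < mult c with hfrequent
  set nice := (L v).filter fun c => ∃ j ∈ Finset.range 9, γ ∈ niceColorings G L S v t c j
    with hnice
  set bad := N.filter fun f => (available G L S f γ).card < 2 * t with hbad
  have h1 : 8 * heavy.card ≤ N.card := by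
    have h : 8 * (heavy.card : ℚ) ≤ ∑ c ∈ L v, colorWeight G L S v γ c :=
      eight_mul_card_le_sum (Finset.filter_subset _ (L v))
        (fun c _ => colorWeight_nonneg v γ c) fun c hc => (Finset.mem_filter.1 hc).2.le
    exact_mod_cast h.trans (sum_colorWeight_le v γ (L v))
  have h2 : 8 * frequent.card ≤ N.card := by
    have h : 8 * (frequent.card : ℚ) ≤ ∑ c ∈ L v, (mult c : ℚ) :=
      eight_mul_card_le_sum (Finset.filter_subset _ (L v)) (fun c _ => Nat.cast_nonneg _)
        fun c hc => by exact_mod_cast (Finset.mem_filter.1 hc).2.le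
    have h' : ∑ c ∈ L v, mult c ≤ N.card := by
      rw [hmult, Finset.sum_card_fiberwise_eq_card_filter]
      exact Finset.card_filter_le _ _
    have h'' : ∑ c ∈ L v, (mult c : ℚ) ≤ N.card := by exact_mod_cast h'
    exact_mod_cast h.trans h''
  have hsub : L v ⊆ ((heavy ∪ frequent) ∪ nice) ∪ bad.image γ := by
    intro c hc
    simp only [Finset.mem_union]
    by_contra! hcon
    obtain ⟨⟨⟨hc1, hc2⟩, hc3⟩, hc4⟩ := hcon
    simp only [hheavy, hfrequent, Finset.mem_filter, hc, true_and, not_lt] at hc1 hc2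
    apply hc3
    refine Finset.mem_filter.2 ⟨hc, mult c, Finset.mem_range.2 (by omega), ?_⟩
    refine Finset.mem_filter.2 ⟨hγ, hc1, rfl, fun f hf hfc => ?_⟩
    have hgood : 2 * t ≤ (available G L S f γ).card := by
      by_contra! hlt
      exact hc4 (Finset.mem_image.2 ⟨f, Finset.mem_filter.2 ⟨hf, hlt⟩, hfc⟩)
    exact hgood.trans (Finset.card_le_card (available_mono (Finset.filter_subset _ _) _ _))
  have h3 := Finset.card_le_card hsub
  have h4 := Finset.card_union_le ((heavy ∪ frequent) ∪ nice) (bad.image γ)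
  have h5 := Finset.card_union_le (heavy ∪ frequent) nice
  have h6 := Finset.card_union_le heavy frequent
  have h7 : (bad.image γ).card ≤ bad.card := Finset.card_image_le
  omega

lemma sum_card_nice_le {v : α} {t : ℕ} (ht : 2 ≤ t)
    (hcodeg : ∀ f ∈ S.filter (G.Adj v), (S.filter fun u => G.Adj v u ∧ G.Adj f u).card ≤ t) :
    ∑ γ ∈ listColorings G L S, ((L v).filter fun c => ∃ j ∈ Finset.range 9,
      γ ∈ niceColorings G L S v t c j).card ≤
        32 ^ 9 * ∑ γ ∈ listColorings G L S, (available G L S v γ).card := by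
  have hswap (p : (α → ℕ) → ℕ → Prop) [∀ γ c, Decidable (p γ c)] :
      ∑ γ ∈ listColorings G L S, ((L v).filter fun c => p γ c).card =
        ∑ c ∈ L v, ((listColorings G L S).filter fun γ => p γ c).card := by
    simp only [Finset.card_filter]
    exact Finset.sum_comm
  have havail (γ : α → ℕ) :
      available G L S v γ = (L v).filter fun c => c ∈ available G L S v γ := by
    ext c
    rw [Finset.mem_filter, iff_and_self]
    exact fun hc => (mem_available.1 hc).1
  rw [hswap, Finset.sum_congr rfl fun γ _ => congrArg Finset.card (havail γ), hswap,
    Finset.mul_sum]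
  refine Finset.sum_le_sum fun c hc => ?_
  have hzero : (niceColorings G L S v t c 0).card ≤
      ((listColorings G L S).filter fun γ => c ∈ available G L S v γ).card := by
    refine Finset.card_le_card fun γ hγ => ?_
    obtain ⟨hγΩ, -, hzero, -⟩ := Finset.mem_filter.1 hγ
    refine Finset.mem_filter.2 ⟨hγΩ, mem_available.2 ⟨hc, fun u hu hvu huc => ?_⟩⟩
    rw [Finset.card_eq_zero, Finset.filter_eq_empty_iff] at hzero
    exact hzero (Finset.mem_filter.2 ⟨hu, hvu⟩) huc
  calc _ ≤ ((Finset.range 9).biUnion fun j => niceColorings G L S v t c j).card :=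
        Finset.card_le_card fun γ hγ => Finset.mem_biUnion.2 (Finset.mem_filter.1 hγ).2
    _ ≤ ∑ j ∈ Finset.range 9, (niceColorings G L S v t c j).card :=
        Finset.card_biUnion_le
    _ ≤ ∑ j ∈ Finset.range 9, 32 ^ j * (niceColorings G L S v t c 0).card :=
        Finset.sum_le_sum fun j _ => card_niceColorings_le ht hcodeg c j
    _ = (∑ j ∈ Finset.range 9, 32 ^ j) * (niceColorings G L S v t c 0).card := by
        rw [Finset.sum_mul]
    _ ≤ 32 ^ 9 * (niceColorings G L S v t c 0).card := by
        gcongr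
        norm_num [Finset.sum_range_succ]
    _ ≤ _ := Nat.mul_le_mul_left _ hzero

/-- If degrees are at most `2 * k` and codegrees of adjacent vertices are tiny compared to `k`,
then a random coloring from lists of size `k` leaves many colors at every further vertex. -/
lemma card_listColorings_le_sum_card_available {k t : ℕ} (hL : ∀ v, (L v).card = k)
    (hdeg : ∀ v, (Finset.univ.filter (G.Adj v)).card ≤ 2 * k) (ht : 2 ≤ t)
    (hcodeg : ∀ v f, G.Adj v f →
      (Finset.univ.filter fun u => G.Adj v u ∧ G.Adj f u).card ≤ t)
    (hk : 64 * 32 ^ 9 * t ≤ k) (S : Finset α) :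
    ∀ v ∉ S, k * (listColorings G L S).card ≤
      4 * 32 ^ 9 * ∑ γ ∈ listColorings G L S, (available G L S v γ).card := by
  induction S using Finset.strongInduction with
  | H S ih =>
  intro v hv
  set N := S.filter (G.Adj v) with hN
  set Ω := listColorings G L S with hΩ
  have hNcard : N.card ≤ 2 * k :=
    (Finset.card_le_card (Finset.filter_subset_filter _ (Finset.subset_univ _))).trans (hdeg v)
  have hcodegS : ∀ f ∈ N, (S.filter fun u => G.Adj v u ∧ G.Adj f u).card ≤ t := fun f hf =>
    (Finset.card_le_card (Finset.filter_subset_filter _ (Finset.subset_univ _))).trans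
      (hcodeg v f (Finset.mem_filter.1 hf).2)
  have hkpos : 0 < k := by
    have : 0 < 64 * 32 ^ 9 * t := by positivity
    omega
  have hbad : ∀ f ∈ N, k * (Ω.filter fun γ => (available G L S f γ).card < 2 * t).card ≤
      8 * 32 ^ 9 * t * Ω.card := by
    intro f hf
    have hfS := (Finset.mem_filter.1 hf).1
    have h1 := card_filter_card_available_lt_le (G := G) (L := L)
      (Finset.notMem_erase f S) (2 * t)
    have h2 := ih (S.erase f) (Finset.erase_ssubset hfS) f (Finset.notMem_erase f S)
    rw [← card_listColorings_insert (Finset.notMem_erase f S)] at h2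
    rw [Finset.insert_erase hfS] at h1 h2
    calc _ ≤ k * (2 * t * (listColorings G L (S.erase f)).card) := by gcongr
      _ = 2 * t * (k * (listColorings G L (S.erase f)).card) := by ring
      _ ≤ 2 * t * (4 * 32 ^ 9 * Ω.card) := by gcongr
      _ = _ := by ring
  have hbad_sum : 4 * ∑ γ ∈ Ω,
      (N.filter fun f => (available G L S f γ).card < 2 * t).card ≤ k * Ω.card := by
    have hswap := Finset.sum_card_bipartiteAbove_eq_sum_card_bipartiteBelow
      (s := Ω) (t := N) (r := fun γ f => (available G L S f γ).card < 2 * t)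
    simp only [Finset.bipartiteAbove, Finset.bipartiteBelow] at hswap
    rw [hswap]
    refine Nat.le_of_mul_le_mul_left ?_ hkpos
    calc k * (4 * ∑ f ∈ N, (Ω.filter fun γ => (available G L S f γ).card < 2 * t).card)
        = 4 * ∑ f ∈ N, k * (Ω.filter fun γ => (available G L S f γ).card < 2 * t).card := by
          rw [← Finset.mul_sum]; ring
      _ ≤ 4 * (N.card * (8 * 32 ^ 9 * t * Ω.card)) := by
          gcongr
          rw [← smul_eq_mul N.card]
          exact Finset.sum_le_card_nsmul _ _ _ hbad
      _ ≤ 4 * (2 * k * (8 * 32 ^ 9 * t * Ω.card)) := by gcongr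
      _ = k * (64 * 32 ^ 9 * t * Ω.card) := by ring
      _ ≤ k * (k * Ω.card) := by gcongr
  have hnice : ∑ γ ∈ Ω, ((L v).filter fun c => ∃ j ∈ Finset.range 9,
      γ ∈ niceColorings G L S v t c j).card ≤
        32 ^ 9 * ∑ γ ∈ Ω, (available G L S v γ).card := sum_card_nice_le ht hcodegS
  have hall := Finset.sum_le_sum fun γ (hγ : γ ∈ Ω) =>
    card_list_le_nice_add_bad (t := t) (hL v) hNcard hγ
  rw [Finset.sum_const, smul_eq_mul, ← Finset.mul_sum, Finset.sum_add_distrib,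
    ← hN] at hall
  rw [mul_comm k] at hbad_sum ⊢
  rw [mul_assoc]
  omega

/-- A graph with degrees at most `2 * k` in which adjacent vertices have few common neighbors
is `k`-choosable. -/
theorem listColorings_nonempty {k t : ℕ} (hL : ∀ v, (L v).card = k)
    (hdeg : ∀ v, (Finset.univ.filter (G.Adj v)).card ≤ 2 * k) (ht : 2 ≤ t)
    (hcodeg : ∀ v f, G.Adj v f →
      (Finset.univ.filter fun u => G.Adj v u ∧ G.Adj f u).card ≤ t)
    (hk : 64 * 32 ^ 9 * t ≤ k) (S : Finset α) : (listColorings G L S).Nonempty := by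
  induction S using Finset.induction_on with
  | empty => exact ⟨fun _ => 0, by simp [mem_listColorings]⟩
  | insert v S hv ih =>
    have h := card_listColorings_le_sum_card_available hL hdeg ht hcodeg hk S v hv
    rw [← card_listColorings_insert hv] at h
    have hkpos : 0 < k := by
      have : 0 < 64 * 32 ^ 9 * t := by positivity
      omega
    have hpos : 0 < k * (listColorings G L S).card := Nat.mul_pos hkpos ih.card_pos
    rw [← Finset.card_pos]
    omega

end CodegreeColoring

section LineGraph

variable {W : Type*}

lemma card_subtype_filter_le (E : Finset (Finset W)) {p : {e // e ∈ E} → Prop}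
    [DecidablePred p] {q : Finset W → Prop} [DecidablePred q] (h : ∀ e, p e → q e.1) :
    (Finset.univ.filter p).card ≤ (E.filter q).card :=
  Finset.card_le_card_of_injOn Subtype.val
    (fun e he => Finset.mem_filter.2 ⟨e.2, h e (Finset.mem_filter.1 he).2⟩)
    Subtype.val_injective.injOn

variable [DecidableEq W]

/-- The line graph of a hypergraph: edges are adjacent if they are distinct and intersect. -/
def hyperLineGraph (E : Finset (Finset W)) : SimpleGraph {e // e ∈ E} where
  Adj e f := e ≠ f ∧ ¬ Disjoint e.1 f.1
  symm := ⟨fun _ _ h => ⟨h.1.symm, fun hd => h.2 hd.symm⟩⟩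
  loopless := ⟨fun _ h => h.1 rfl⟩

instance (E : Finset (Finset W)) : DecidableRel (hyperLineGraph E).Adj :=
  fun e f => inferInstanceAs (Decidable (e ≠ f ∧ ¬ Disjoint e.1 f.1))

lemma card_meeting_le_sum_deg (E : Finset (Finset W)) (e : Finset W) :
    (E.filter fun f => ¬ Disjoint e f).card ≤ ∑ x ∈ e, deg E x := by
  refine (Finset.card_le_card fun f hf => ?_).trans
    (Finset.card_biUnion_le (s := e) (t := fun x => E.filter fun f => x ∈ f))
  obtain ⟨hfE, hef⟩ := Finset.mem_filter.1 hf
  obtain ⟨x, hxe, hxf⟩ := Finset.not_disjoint_iff.1 hef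
  exact Finset.mem_biUnion.2 ⟨x, hxe, Finset.mem_filter.2 ⟨hfE, hxf⟩⟩

/-- In a linear hypergraph two vertices lie in at most one common edge. -/
lemma Linear.card_filter_mem_mem_le_one {E : Finset (Finset W)} (hE : Linear E) {y z : W}
    (hyz : y ≠ z) : (E.filter fun g => y ∈ g ∧ z ∈ g).card ≤ 1 := by
  refine Finset.card_le_one.2 fun g hg h hh => ?_
  simp only [Finset.mem_filter] at hg hh
  by_contra hne
  have h2 : ({y, z} : Finset W) ⊆ g ∩ h := by
    intro x hx
    rcases Finset.mem_insert.1 hx with rfl | hx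
    · exact Finset.mem_inter.2 ⟨hg.2.1, hh.2.1⟩
    · rw [Finset.mem_singleton.1 hx]
      exact Finset.mem_inter.2 ⟨hg.2.2, hh.2.2⟩
  have h3 := (Finset.card_le_card h2).trans (hE g hg.1 h hh.1 hne)
  rw [Finset.card_pair hyz] at h3
  omega

lemma Linear.card_meeting_both_le {E : Finset (Finset W)} (hE : Linear E) {P Δ : ℕ}
    (hP : ∀ e ∈ E, e.card ≤ P) (hΔ : ∀ x, deg E x ≤ Δ) {e f : Finset W} (he : e ∈ E)
    (hf : f ∈ E) (hef : e ≠ f) (hmeet : ¬ Disjoint e f) :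
    (E.filter fun g => ¬ Disjoint e g ∧ ¬ Disjoint f g).card ≤
      Δ + (P - 1) * (P - 1) := by
  obtain ⟨x, hxe, hxf⟩ := Finset.not_disjoint_iff.1 hmeet
  have hsub : (E.filter fun g => ¬ Disjoint e g ∧ ¬ Disjoint f g) ⊆
      (E.filter fun g => x ∈ g) ∪ (e.erase x ×ˢ f.erase x).biUnion
        fun p => E.filter fun g => p.1 ∈ g ∧ p.2 ∈ g := by
    intro g hg
    simp only [Finset.mem_filter] at hg
    obtain ⟨hgE, heg, hfg⟩ := hg
    obtain ⟨y, hye, hyg⟩ := Finset.not_disjoint_iff.1 heg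
    obtain ⟨z, hzf, hzg⟩ := Finset.not_disjoint_iff.1 hfg
    by_cases hxg : x ∈ g
    · exact Finset.mem_union_left _ (Finset.mem_filter.2 ⟨hgE, hxg⟩)
    · refine Finset.mem_union_right _ (Finset.mem_biUnion.2 ⟨(y, z), ?_, ?_⟩)
      · have hyx : y ≠ x := fun h => hxg (h ▸ hyg)
        have hzx : z ≠ x := fun h => hxg (h ▸ hzg)
        simp [hye, hzf, hyx, hzx]
      · exact Finset.mem_filter.2 ⟨hgE, hyg, hzg⟩
  have hpair : ∀ p ∈ e.erase x ×ˢ f.erase x,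
      (E.filter fun g => p.1 ∈ g ∧ p.2 ∈ g).card ≤ 1 := by
    intro p hp
    obtain ⟨hp1, hp2⟩ := Finset.mem_product.1 hp
    refine hE.card_filter_mem_mem_le_one fun heq => ?_
    exact (Finset.mem_erase.1 hp1).1 (Finset.card_le_one.1 (hE e he f hf hef) _
      (Finset.mem_inter.2 ⟨Finset.mem_of_mem_erase hp1, heq ▸ Finset.mem_of_mem_erase hp2⟩) _
      (Finset.mem_inter.2 ⟨hxe, hxf⟩))
  have h1 : (e.erase x).card ≤ P - 1 := by
    rw [Finset.card_erase_of_mem hxe]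
    exact Nat.sub_le_sub_right (hP e he) 1
  have h2 : (f.erase x).card ≤ P - 1 := by
    rw [Finset.card_erase_of_mem hxf]
    exact Nat.sub_le_sub_right (hP f hf) 1
  calc _ ≤ _ := Finset.card_le_card hsub
    _ ≤ _ := Finset.card_union_le _ _
    _ ≤ Δ + (e.erase x ×ˢ f.erase x).card * 1 :=
        Nat.add_le_add (hΔ x) (Finset.card_biUnion_le_card_mul _ _ _ hpair)
    _ ≤ Δ + (P - 1) * (P - 1) := by
        rw [mul_one, Finset.card_product]
        gcongr

/-- Passing from the line graph to the hypergraph. -/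
lemma listColorable_of_listColorings_nonempty {E : Finset (Finset W)} {k : ℕ}
    (h : ∀ L : {e // e ∈ E} → Finset ℕ, (∀ e, (L e).card = k) →
      (listColorings (hyperLineGraph E) L Finset.univ).Nonempty) : ListColorable E k := by
  intro L hL
  obtain ⟨γ, hγ⟩ := h (fun e => L e.1) fun e => hL e.1 e.2
  rw [mem_listColorings] at hγ
  refine ⟨fun e => if he : e ∈ E then γ ⟨e, he⟩ else 0, fun e he => ?_, ?_⟩
  · simpa [he] using hγ.1 ⟨e, he⟩ (Finset.mem_univ _)
  · intro e he f hf hef heq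
    simp only [he, hf, dif_pos] at heq
    by_contra hmeet
    exact hγ.2.2 ⟨e, he⟩ (Finset.mem_univ _) ⟨f, hf⟩ (Finset.mem_univ _)
      ⟨fun h => hef (congrArg Subtype.val h), hmeet⟩ heq

end LineGraph

/-- There is a universal constant `C ≥ 3` such that every linear hypergraph with no
rank-1 edges, maximum rank `P ≥ C` and maximum degree `Δ ≥ C(P - 1)` satisfies
`q_list(H) ≤ Δ(P - 1)`. -/
theorem stmt5 :
    ∃ C : ℕ, 3 ≤ C ∧
      ∀ (V : Type) [DecidableEq V] [Fintype V] (E : Finset (Finset V)) (P Δ : ℕ),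
        Linear E → (∀ e ∈ E, 2 ≤ e.card) →
        P = E.sup Finset.card → Δ = Finset.univ.sup (deg E) →
        C ≤ P → C * (P - 1) ≤ Δ →
        qList E ≤ Δ * (P - 1) := by
  refine ⟨128 * 32 ^ 9 + 1, by norm_num, fun V _ _ E P Δ hE _ hP hΔ hCP hCΔ => ?_⟩
  have hrank : ∀ e ∈ E, e.card ≤ P := fun e he => hP ▸ Finset.le_sup (f := Finset.card) he
  have hdeg : ∀ x, deg E x ≤ Δ := fun x => hΔ ▸ Finset.le_sup (f := deg E) (Finset.mem_univ x)
  obtain ⟨Q, rfl⟩ : ∃ Q, P = Q + 1 := ⟨P - 1, by omega⟩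
  rw [Nat.add_sub_cancel] at hCΔ ⊢
  have hQ : 128 * 32 ^ 9 ≤ Q := by omega
  have hQΔ : 128 * 32 ^ 9 * Q ≤ Δ := le_trans (by gcongr; omega) hCΔ
  refine Nat.sInf_le (listColorable_of_listColorings_nonempty fun L hL => ?_)
  refine listColorings_nonempty (t := Δ + Q * Q) hL (fun e => ?_) ?_ (fun e f hef => ?_) ?_ _
  · calc _ ≤ (E.filter fun f => ¬ Disjoint e.1 f).card :=
          card_subtype_filter_le E fun f hf => hf.2
      _ ≤ ∑ x ∈ e.1, deg E x := card_meeting_le_sum_deg E e.1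
      _ ≤ e.1.card * Δ := Finset.sum_le_card_nsmul _ _ _ fun x _ => hdeg x
      _ ≤ (Q + 1) * Δ := by gcongr; exact hrank e.1 e.2
      _ ≤ (Q + Q) * Δ := by gcongr; omega
      _ = 2 * (Δ * Q) := by ring
  · omega
  · calc _ ≤ (E.filter fun g => ¬ Disjoint e.1 g ∧ ¬ Disjoint f.1 g).card :=
          card_subtype_filter_le E fun g hg => ⟨hg.1.2, hg.2.2⟩
      _ ≤ _ := hE.card_meeting_both_le hrank hdeg e.2 f.2
          (fun h => hef.1 (Subtype.ext h)) hef.2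
  · have h1 := Nat.mul_le_mul_left Δ hQ
    have h2 := Nat.mul_le_mul_right Q hQΔ
    have h3 : 128 * 32 ^ 9 * Q * Q = 128 * 32 ^ 9 * (Q * Q) := by ring
    omega
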